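/- Let G be a (P5,dart)-free finite simple graph containing an induced 5-cycle C with vertices v1,...,v5, and let S2 and S5 be defined with respect to C as in the context. If S2 is nonempty then S5 is empty (equivalently, if S5 is nonempty then S2 is empty); that is, S2 and S5 cannot both be nonempty. -/

import Mathlib

open SimpleGraph

/-- `G` contains an induced subgraph isomorphic to `H`. -/
def ContainsInduced {V : Type*} {W : Type*} (G : SimpleGraph V) (H : SimpleGraph W) : Prop :=
  ∃ f : W ↪ V, ∀ a b, H.Adj a b ↔ G.Adj (f a) (f b)

/-- The path on 5 vertices. -/
def P5 : SimpleGraph (Fin 5) := SimpleGraph.pathGraph 5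

/-- The dart: vertices `0,1,2,3,4` and edges `01, 12, 23, 30, 02, 24`. -/
def dart : SimpleGraph (Fin 5) :=
  SimpleGraph.fromRel (fun a b =>
    (a, b) = (0, 1) ∨ (a, b) = (1, 2) ∨ (a, b) = (2, 3) ∨
    (a, b) = (3, 0) ∨ (a, b) = (0, 2) ∨ (a, b) = (2, 4))

/-- `G` is `k`-vertex-critical: `χ(G) = k` and `χ(G - v) < k` for every vertex `v`. -/
def IsVertexCritical {V : Type*} (G : SimpleGraph V) (k : ℕ) : Prop :=
  G.chromaticNumber = k ∧
  ∀ v : V, (G.induce {u | u ≠ v}).chromaticNumber < k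

/-- The cycle on 5 vertices (indices in `Fin 5`, `i` adjacent to `i + 1`). -/
def C5 : SimpleGraph (Fin 5) := SimpleGraph.fromRel (fun a b => b = a + 1)

/-- `S0`: the vertices off the 5-cycle `v` with no neighbour on it. -/
def S0 {V : Type*} (G : SimpleGraph V) (v : Fin 5 → V) : Set V :=
  {u | u ∉ Set.range v ∧ ∀ j, ¬ G.Adj u (v j)}

/-- `S2(i)`: vertices off the 5-cycle `v` whose neighbourhood on it is exactly
`{v (i-1), v (i+1)}`. -/
def S2 {V : Type*} (G : SimpleGraph V) (v : Fin 5 → V) (i : Fin 5) : Set V :=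
  {u | u ∉ Set.range v ∧ ∀ j, G.Adj u (v j) ↔ (j = i - 1 ∨ j = i + 1)}

/-- `S3^1(i)`: vertices off the 5-cycle `v` whose neighbourhood on it is exactly
`{v (i-1), v i, v (i+1)}`. -/
def S31 {V : Type*} (G : SimpleGraph V) (v : Fin 5 → V) (i : Fin 5) : Set V :=
  {u | u ∉ Set.range v ∧ ∀ j, G.Adj u (v j) ↔ (j = i - 1 ∨ j = i ∨ j = i + 1)}

/-- `S3^2(i)`: vertices off the 5-cycle `v` whose neighbourhood on it is exactly
`{v (i-2), v i, v (i+2)}`. -/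
def S32 {V : Type*} (G : SimpleGraph V) (v : Fin 5 → V) (i : Fin 5) : Set V :=
  {u | u ∉ Set.range v ∧ ∀ j, G.Adj u (v j) ↔ (j = i - 2 ∨ j = i ∨ j = i + 2)}

/-- `S4(i)`: vertices off the 5-cycle `v` whose neighbourhood on it is exactly
`{v (i-2), v (i-1), v (i+1), v (i+2)}`. -/
def S4 {V : Type*} (G : SimpleGraph V) (v : Fin 5 → V) (i : Fin 5) : Set V :=
  {u | u ∉ Set.range v ∧
    ∀ j, G.Adj u (v j) ↔ (j = i - 2 ∨ j = i - 1 ∨ j = i + 1 ∨ j = i + 2)}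

/-- `S5`: vertices off the 5-cycle `v` adjacent to all five of its vertices. -/
def S5 {V : Type*} (G : SimpleGraph V) (v : Fin 5 → V) : Set V :=
  {u | u ∉ Set.range v ∧ ∀ j, G.Adj u (v j)}

/-- A diamond `a b c d` with chord `ac` and a pendant vertex `e` at `c` is an induced dart. -/
theorem containsInduced_dart {V : Type*} {G : SimpleGraph V} {a b c d e : V} (hbd : b ≠ d)
    (hab : G.Adj a b) (hbc : G.Adj b c) (hcd : G.Adj c d) (hda : G.Adj d a) (hac : G.Adj a c)
    (hce : G.Adj c e) (nbd : ¬ G.Adj b d) (nae : ¬ G.Adj a e) (nbe : ¬ G.Adj b e)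
    (nde : ¬ G.Adj d e) : ContainsInduced G dart := by
  have hae : a ≠ e := by rintro rfl; exact nbe hab.symm
  have hbe : b ≠ e := by rintro rfl; exact nae hab
  have hde : d ≠ e := by rintro rfl; exact nae hda.symm
  refine ⟨⟨![a, b, c, d, e], ?_⟩, ?_⟩
  · intro x y hxy
    fin_cases x <;> fin_cases y <;>
      simp_all [hab.ne, hab.ne', hbc.ne, hbc.ne', hcd.ne, hcd.ne', hda.ne, hda.ne', hac.ne,
        hac.ne', hce.ne, hce.ne', hbd.symm, hae.symm, hbe.symm, hde.symm]
  · intro x y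
    change dart.Adj x y ↔ G.Adj (![a, b, c, d, e] x) (![a, b, c, d, e] y)
    fin_cases x <;> fin_cases y <;> simp [dart, hab, hbc, hcd, hda, hac, hce, nbd, nae, nbe, nde,
      hab.symm, hbc.symm, hcd.symm, hda.symm, hac.symm, hce.symm, mt Adj.symm nbd, mt Adj.symm nae,
      mt Adj.symm nbe, mt Adj.symm nde]

theorem S2_nonempty_implies_S5_empty {V : Type} [Fintype V] (G : SimpleGraph V)
    (hP5 : ¬ ContainsInduced G P5) (hdart : ¬ ContainsInduced G dart)
    (v : Fin 5 → V) (hinj : Function.Injective v)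
    (hC : ∀ i j, G.Adj (v i) (v j) ↔ C5.Adj i j) :
    (⋃ i, S2 G v i).Nonempty → S5 G v = ∅ := by
  rintro ⟨x, hx⟩
  obtain ⟨i, hxC, hx⟩ := Set.mem_iUnion.1 hx
  refine Set.eq_empty_of_forall_notMem fun y ⟨_, hy⟩ => hdart ?_
  have adj (j : Fin 5) : G.Adj (v j) (v (j + 1)) :=
    (hC _ _).2 (by revert j; simp [C5])
  have not_adj (j : Fin 5) : ¬ G.Adj (v j) (v (j + 2)) :=
    (hC _ _).not.2 (by revert j; simp only [C5, fromRel_adj]; decide)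
  have not_adj' (j : Fin 5) : ¬ G.Adj (v j) (v (j + 3)) :=
    (hC _ _).not.2 (by revert j; simp only [C5, fromRel_adj]; decide)
  have adj₁₂ : G.Adj (v (i + 1)) (v (i + 2)) := by
    convert adj (i + 1) using 2
    rw [add_assoc]; rfl
  have not_adj₁₃ : ¬ G.Adj (v (i + 1)) (v (i + 3)) := by
    convert not_adj (i + 1) using 3
    rw [add_assoc]; rfl
  have hx₁ : G.Adj x (v (i + 1)) := (hx _).2 (Or.inr rfl)
  have hx₀ : ¬ G.Adj x (v i) :=
    (hx _).not.2 (by clear * - i; revert i; decide)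
  have hx₂ : ¬ G.Adj x (v (i + 2)) :=
    (hx _).not.2 (by clear * - i; revert i; decide)
  have hx₃ : ¬ G.Adj x (v (i + 3)) :=
    (hx _).not.2 (by clear * - i; revert i; decide)
  by_cases hxy : G.Adj x y
  · have hne : x ≠ v i := fun h => hxC ⟨i, h.symm⟩
    exact containsInduced_dart hne hx₁.symm hxy (hy i) (adj i) (hy (i + 1)).symm (hy (i + 3))
      hx₀ not_adj₁₃ hx₃ (not_adj' i)
  · have hne : v i ≠ v (i + 2) := fun h => absurd (hinj h) (by simp)
    exact containsInduced_dart hne (hy i) (adj i) adj₁₂ (hy (i + 2)).symm (hy (i + 1)) hx₁.symm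
      (not_adj i) (fun h => hxy h.symm) (fun h => hx₀ h.symm) (fun h => hx₂ h.symm)
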